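/- arXiv:2211.05753 — 4 statements merged into one kernel-verified Lean document; each statement's English description precedes it below -/
import Mathlib

section
/- Let (n_i)_{i≥1} be a non-increasing sequence of positive real numbers such that n := Σ_{i≥1} n_i < ∞. Then either √(n_1) + √(n_2) ≥ √n, or there exists an integer ℓ ≥ 3 such that ℓ·√(n_ℓ) ≥ √n. -/
/-- If `b (i + m + 1) ≤ c / (i + m + 1) ^ 2` for all `i`, the partial sums of the tail of `b` are
bounded by comparison with the telescoping series of `1 / (l ^ 2 - 1 / 4)`. -/
theorem sum_range_le_div_of_le_div_sq (b : ℕ → ℝ) {c : ℝ} (hc : 0 ≤ c) (m : ℕ)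
    (hb : ∀ i, ((i + m + 1 : ℕ) : ℝ) ^ 2 * b (i + m + 1) ≤ c) (k : ℕ) :
    ∑ i ∈ Finset.range k, b (i + m + 1) ≤ c / (m + 1 / 2) - c / (k + m + 1 / 2) := by
  induction k with
  | zero => simp
  | succ k ih =>
    rw [Finset.sum_range_succ]
    have h := hb k
    push_cast at h ⊢
    set l : ℝ := k + m + 1 with hl
    have hl1 : 1 ≤ l := by rw [hl]; linarith [k.cast_nonneg (α := ℝ), m.cast_nonneg (α := ℝ)]
    have h1 : b (k + m + 1) ≤ c / l ^ 2 := by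
      rw [le_div_iff₀ (by positivity)]
      linarith
    have h2 : c / l ^ 2 ≤ c / (l ^ 2 - 1 / 4) :=
      div_le_div_of_nonneg_left hc (by nlinarith) (by linarith)
    have h3 : c / (l ^ 2 - 1 / 4) = c / (l - 1 / 2) - c / (l + 1 / 2) := by
      rw [div_sub_div _ _ (by linarith) (by linarith)]
      congr 1 <;> ring
    have e1 : (k : ℝ) + m + 1 / 2 = l - 1 / 2 := by rw [hl]; ring
    have e2 : (k : ℝ) + 1 + m + 1 / 2 = l + 1 / 2 := by rw [hl]; ring
    rw [e1] at ih
    rw [e2]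
    linarith

/-- BBM Proposition 11. Let `(a i)_{i ≥ 1}` be a
non-increasing sequence of positive reals with finite sum `n`. Then either
`√(a 1) + √(a 2) ≥ √n`, or there exists `ℓ ≥ 3` with `ℓ·√(a ℓ) ≥ √n`. -/
theorem sqrt_dichotomy (a : ℕ → ℝ) (hpos : ∀ i, 1 ≤ i → 0 < a i)
    (hmono : ∀ i j, 1 ≤ i → i ≤ j → a j ≤ a i)
    (hsum : Summable fun i : ℕ => a (i + 1)) (n : ℝ)
    (hn : n = ∑' i : ℕ, a (i + 1)) :
    Real.sqrt n ≤ Real.sqrt (a 1) + Real.sqrt (a 2) ∨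
      ∃ l : ℕ, 3 ≤ l ∧ Real.sqrt n ≤ (l : ℝ) * Real.sqrt (a l) := by
  by_contra! ⟨h12, hl⟩
  have hn0 : 0 ≤ n := hn ▸ tsum_nonneg fun i => (hpos (i + 1) (by lia)).le
  have hx : √(a 1) ^ 2 = a 1 := Real.sq_sqrt (hpos 1 le_rfl).le
  have hy : √(a 2) ^ 2 = a 2 := Real.sq_sqrt (hpos 2 (by lia)).le
  have hs : √n ^ 2 = n := Real.sq_sqrt hn0
  have hx0 : 0 < √(a 1) := Real.sqrt_pos.2 (hpos 1 le_rfl)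
  have hy0 : 0 < √(a 2) := Real.sqrt_pos.2 (hpos 2 (by lia))
  have hyx : √(a 2) ≤ √(a 1) := Real.sqrt_le_sqrt (hmono 1 2 le_rfl (by lia))
  set x := √(a 1)
  set y := √(a 2)
  set s := √n
  obtain ⟨m, hm⟩ : ∃ m, m = ⌊s / y⌋₊ := ⟨_, rfl⟩
  have hm2 : 2 ≤ m := by
    rw [hm]
    apply Nat.le_floor
    rw [le_div_iff₀ hy0]
    push_cast
    linarith
  have hms : m * y ≤ s := by
    rw [← le_div_iff₀ hy0, hm]
    exact Nat.floor_le (by positivity)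
  have hsm : s < (m + 1) * y := by
    rw [← div_lt_iff₀ hy0, hm]
    exact Nat.lt_floor_add_one _
  have htail : ∑' i, a (i + m + 1) ≤ n / (m + 1 / 2) := by
    refine Real.tsum_le_of_sum_range_le (fun i => (hpos _ (by lia)).le) fun k => ?_
    refine (sum_range_le_div_of_le_div_sq a hn0 m (fun i => ?_) k).trans
      (sub_le_self _ (by positivity))
    have h := hl (i + m + 1) (by lia)
    rw [← hs, ← Real.sq_sqrt (hpos (i + m + 1) (by lia)).le, ← mul_pow]
    exact pow_le_pow_left₀ (by positivity) h.le 2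
  have hhead : ∑ i ∈ Finset.range m, a (i + 1) ≤ x ^ 2 + (m - 1) * y ^ 2 := by
    obtain ⟨k, rfl⟩ : ∃ k, m = k + 1 := ⟨m - 1, by lia⟩
    rw [Finset.sum_range_succ', hx, hy]
    have h := Finset.sum_le_card_nsmul (Finset.range k) (fun i => a (i + 1 + 1)) (a 2)
      fun i _ => hmono 2 (i + 1 + 1) (by lia) (by lia)
    simp only [Finset.card_range, nsmul_eq_mul] at h
    push_cast
    linarith
  have hsplit := hsum.sum_add_tsum_nat_add m
  have hquad : n / (m + 1 / 2) ≤ 2 * s * y - m * y ^ 2 := by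
    rw [div_le_iff₀ (by positivity), ← hs]
    have hprod : 0 ≤ (s - m * y) * ((m + 1) * y - s) :=
      mul_nonneg (by linarith) (by linarith)
    have : 0 ≤ (m : ℝ) * y ^ 2 := by positivity
    linarith
  have hxs : x ^ 2 < (s - y) ^ 2 := pow_lt_pow_left₀ (by linarith) hx0.le two_ne_zero
  rw [← hn] at hsplit
  linarith
end

section
/- There exists a constant λ ∈ (0,1] such that for every binomial random variable X with parameters N ∈ ℕ and p ∈ (0, 1/2] whose mean μ = Np satisfies μ ≥ 4, and for every δ ∈ [0,1], it holds that Pr[X ≤ (1−δ)μ] ≥ λ·e^{−δ²μ/λ}. -/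
/-- The probability that a `Bin(N, p)` random variable takes the value `k`. -/
noncomputable def binomialWeight (N : ℕ) (p : ℝ) (k : ℕ) : ℝ :=
  (N.choose k : ℝ) * p ^ k * (1 - p) ^ (N - k)

lemma binomialWeight_nonneg {p : ℝ} (h0 : 0 ≤ p) (h1 : p ≤ 1) (N k : ℕ) :
    0 ≤ binomialWeight N p k := by
  have : 0 ≤ 1 - p := by linarith
  unfold binomialWeight
  positivity

lemma sum_binomialWeight (N : ℕ) (p : ℝ) :
    ∑ k ∈ Finset.range (N + 1), binomialWeight N p k = 1 := by
  have h := add_pow p (1 - p) N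
  rw [add_sub_cancel, one_pow] at h
  rw [h]
  refine Finset.sum_congr rfl fun k _ => ?_
  unfold binomialWeight
  ring

lemma sum_sq_sub_mul_binomialWeight (N : ℕ) (p : ℝ) :
    ∑ k ∈ Finset.range (N + 1), (N * p - k) ^ 2 * binomialWeight N p k = N * p * (1 - p) := by
  have h := congrArg (Polynomial.eval p) (bernsteinPolynomial.variance ℝ N)
  simpa [Polynomial.eval_finsetSum, bernsteinPolynomial, binomialWeight] using h

/-- Chebyshev's inequality for the upper tail of the binomial distribution. -/
lemma one_sub_le_sum_binomialWeight {N : ℕ} {p t : ℝ} (h0 : 0 ≤ p) (h1 : p ≤ 1) (ht : 0 < t) :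
    1 - N * p * (1 - p) / t ^ 2 ≤
      ∑ k ∈ Finset.range (N + 1), if (k : ℝ) ≤ N * p + t then binomialWeight N p k else 0 := by
  rw [← sum_sq_sub_mul_binomialWeight N p, ← sum_binomialWeight N p, Finset.sum_div,
    ← Finset.sum_sub_distrib]
  refine Finset.sum_le_sum fun k _ => ?_
  have hb := binomialWeight_nonneg h0 h1 N k
  split_ifs with hk
  · have : 0 ≤ (N * p - k) ^ 2 * binomialWeight N p k / t ^ 2 := by positivity
    linarith
  · have hsq : t ^ 2 ≤ (N * p - k) ^ 2 := by nlinarith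
    rw [sub_nonpos, le_div_iff₀ (by positivity), mul_comm]
    exact mul_le_mul_of_nonneg_right hsq hb

/-- Change of measure between two binomial distributions, by Cauchy–Schwarz: the second moment of
the likelihood ratio is at most `exp (N * (x - p) ^ 2 / (p * (1 - p)))`. -/
lemma sq_sum_binomialWeight_le {N : ℕ} {p x : ℝ} (hp0 : 0 < p) (hp1 : p < 1)
    (A : ℕ → Prop) [DecidablePred A] :
    (∑ k ∈ Finset.range (N + 1), if A k then binomialWeight N x k else 0) ^ 2 ≤
      (∑ k ∈ Finset.range (N + 1), if A k then binomialWeight N p k else 0) *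
        Real.exp (N * ((x - p) ^ 2 / (p * (1 - p)))) := by
  have hq : 0 < 1 - p := by linarith
  have hnn : ∀ k, 0 ≤ if A k then binomialWeight N p k else 0 := fun k => by
    split_ifs
    · exact binomialWeight_nonneg hp0.le hp1.le N k
    · exact le_rfl
  have hcs := Finset.sum_sq_le_sum_mul_sum_of_sq_le_mul (Finset.range (N + 1))
    (r := fun k => if A k then binomialWeight N x k else 0)
    (f := fun k => if A k then binomialWeight N p k else 0)
    (g := fun k => (x ^ 2 / p) ^ k * ((1 - x) ^ 2 / (1 - p)) ^ (N - k) * (N.choose k : ℝ))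
    (fun k _ => hnn k) (fun k _ => by positivity) (fun k _ => le_of_eq <| by
      split_ifs
      · unfold binomialWeight
        rw [div_pow, div_pow, pow_right_comm x 2, pow_right_comm (1 - x) 2]
        field_simp
      · simp)
  refine hcs.trans (mul_le_mul_of_nonneg_left ?_ (Finset.sum_nonneg fun k _ => hnn k))
  rw [← add_pow, Real.exp_nat_mul]
  have : x ^ 2 / p + (1 - x) ^ 2 / (1 - p) = (x - p) ^ 2 / (p * (1 - p)) + 1 := by
    field_simp
    ring
  rw [this]
  exact pow_le_pow_left₀ (by positivity) (Real.add_one_le_exp _) N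

lemma exp_neg_two_mul_le_one_sub {p : ℝ} (h0 : 0 ≤ p) (h1 : p ≤ 1 / 2) :
    Real.exp (-(2 * p)) ≤ 1 - p := by
  rw [Real.exp_neg, inv_le_comm₀ (Real.exp_pos _) (by linarith)]
  refine le_trans ?_ (Real.add_one_le_exp (2 * p))
  rw [inv_le_iff_one_le_mul₀ (by linarith)]
  nlinarith

lemma exp_neg_le_binomial_lower_tail {N : ℕ} {p a : ℝ} (h0 : 0 ≤ p) (h1 : p ≤ 1 / 2)
    (ha : 0 ≤ a) :
    Real.exp (-(2 * (N * p))) ≤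
      ∑ k ∈ Finset.range (N + 1), if (k : ℝ) ≤ a then binomialWeight N p k else 0 := by
  have hz : Real.exp (-(2 * (N * p))) ≤ binomialWeight N p 0 := by
    have := pow_le_pow_left₀ (Real.exp_pos _).le (exp_neg_two_mul_le_one_sub h0 h1) N
    rw [← Real.exp_nat_mul] at this
    simpa [binomialWeight, mul_left_comm] using this
  refine hz.trans ?_
  have := Finset.single_le_sum (s := Finset.range (N + 1))
    (f := fun k : ℕ => if (k : ℝ) ≤ a then binomialWeight N p k else 0) (fun k _ => by
      split_ifs
      · exact binomialWeight_nonneg h0 (by linarith) N k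
      · exact le_rfl) (Finset.mem_range.mpr N.succ_pos)
  simpa [ha] using this

/-- The lower tail bound for deviations that are bounded away from `1`. -/
lemma exp_le_binomial_lower_tail {N : ℕ} {p δ : ℝ} (hp0 : 0 < p) (hp1 : p ≤ 1 / 2)
    (hμ : 4 ≤ N * p) (hδ0 : 0 ≤ δ) (hδ1 : δ ≤ 1 / 4) :
    Real.exp (-11) * Real.exp (-(4 * (δ ^ 2 * (N * p)))) ≤
      ∑ k ∈ Finset.range (N + 1),
        if (k : ℝ) ≤ (1 - δ) * (N * p) then binomialWeight N p k else 0 := by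
  obtain ⟨s, hs, hsμ⟩ : ∃ s : ℝ, 2 ≤ s ∧ s ^ 2 = N * p :=
    ⟨√(N * p), Real.le_sqrt_of_sq_le (by linarith), Real.sq_sqrt (by linarith)⟩
  have hN : (0 : ℝ) < N := by
    by_contra h
    nlinarith
  have hs0 : 0 < s := by linarith
  set x : ℝ := ((1 - δ) * (N * p) - 3 / 2 * s) / N with hx
  have hNx : N * x = (1 - δ) * (N * p) - 3 / 2 * s := by
    rw [hx]
    field_simp
  have hNx' : N * x ≤ N * p := by
    rw [hNx]
    nlinarith
  have hx0 : 0 ≤ x := by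
    refine div_nonneg ?_ hN.le
    rw [← hsμ]
    nlinarith [mul_nonneg hs0.le (by linarith : 0 ≤ s - 2), mul_nonneg (sq_nonneg s)
      (by linarith : 0 ≤ 1 / 4 - δ)]
  have hxp : x ≤ p := le_of_mul_le_mul_left hNx' hN
  have hcheb := one_sub_le_sum_binomialWeight (N := N) hx0 (by linarith : x ≤ 1)
    (by positivity : 0 < 3 / 2 * s)
  have hvar : N * x * (1 - x) / (3 / 2 * s) ^ 2 ≤ 4 / 9 := by
    rw [div_le_iff₀ (by positivity)]
    have : 0 ≤ N * x * x := by positivity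
    nlinarith
  have hcut : N * x + 3 / 2 * s = (1 - δ) * (N * p) := by
    rw [hNx]
    ring
  rw [hcut] at hcheb
  have hcs := sq_sum_binomialWeight_le (N := N) (x := x) hp0 (by linarith)
    (fun k => (k : ℝ) ≤ (1 - δ) * (N * p))
  have hchi : N * ((x - p) ^ 2 / (p * (1 - p))) ≤ 4 * (δ ^ 2 * (N * p)) + 9 := by
    have hq : 0 < 1 - p := by linarith
    have hNxp : N * (x - p) = -(s * (δ * s + 3 / 2)) := by
      rw [mul_sub, hNx, ← hsμ]
      ring
    have heq : N * ((x - p) ^ 2 / (p * (1 - p))) = (δ * s + 3 / 2) ^ 2 / (1 - p) := by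
      have h2 : N * ((x - p) ^ 2 / (p * (1 - p))) =
          (N * (x - p)) ^ 2 / ((N * p) * (1 - p)) := by
        field_simp
      rw [h2, hNxp, ← hsμ]
      field_simp
    rw [heq, div_le_iff₀ hq, ← hsμ]
    have : 0 ≤ (4 * (δ ^ 2 * s ^ 2) + 9) * (1 / 2 - p) :=
      mul_nonneg (by positivity) (by linarith)
    nlinarith [sq_nonneg (δ * s - 3 / 2)]
  set T := ∑ k ∈ Finset.range (N + 1),
    if (k : ℝ) ≤ (1 - δ) * (N * p) then binomialWeight N p k else 0
  set S := ∑ k ∈ Finset.range (N + 1),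
    if (k : ℝ) ≤ (1 - δ) * (N * p) then binomialWeight N x k else 0
  set E := N * ((x - p) ^ 2 / (p * (1 - p)))
  have hexp : Real.exp (-2) ≤ S ^ 2 := by
    have h1 : Real.exp (-1) ≤ S := by
      have := Real.exp_neg_one_lt_d9
      linarith
    calc Real.exp (-2) = Real.exp (-1) ^ 2 := by
          rw [← Real.exp_nat_mul]
          norm_num
      _ ≤ S ^ 2 := pow_le_pow_left₀ (Real.exp_pos _).le h1 2
  calc Real.exp (-11) * Real.exp (-(4 * (δ ^ 2 * (N * p))))
      ≤ Real.exp (-2) * Real.exp (-E) := by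
        rw [← Real.exp_add, ← Real.exp_add]
        exact Real.exp_le_exp.mpr (by linarith)
    _ ≤ T * Real.exp E * Real.exp (-E) :=
        mul_le_mul_of_nonneg_right (hexp.trans hcs) (Real.exp_pos _).le
    _ = T := by rw [mul_assoc, ← Real.exp_add, add_neg_cancel, Real.exp_zero, mul_one]


/-- BBM Lemma 30. There is a constant `λ ∈ (0,1]` such that
for every binomial random variable `X ∼ Bin(N, p)` with `p ≤ 1/2` and mean
`μ = N·p ≥ 4`, and every `δ ∈ [0,1]`,
`Pr[X ≤ (1-δ)·μ] ≥ λ·exp(-δ²·μ/λ)`. -/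
theorem binomial_lower_deviation :
    ∃ lam : ℝ, 0 < lam ∧ lam ≤ 1 ∧
      ∀ (N : ℕ) (p : ℝ), 0 < p → p ≤ 1 / 2 → 4 ≤ (N : ℝ) * p →
        ∀ δ : ℝ, 0 ≤ δ → δ ≤ 1 →
          lam * Real.exp (-(δ ^ 2 * ((N : ℝ) * p)) / lam) ≤
            ∑ k ∈ Finset.range (N + 1),
              if (k : ℝ) ≤ (1 - δ) * ((N : ℝ) * p) then
                (N.choose k : ℝ) * p ^ k * (1 - p) ^ (N - k)
              else 0 := by
  have hlam : Real.exp (-11) ≤ 1 / 32 := by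
    have h1 : Real.exp (-1) ≤ 1 / 2 := by
      have := Real.exp_neg_one_lt_d9
      linarith
    calc Real.exp (-11) = Real.exp (-1) ^ 11 := by
          rw [← Real.exp_nat_mul]
          norm_num
      _ ≤ (1 / 2) ^ 11 := pow_le_pow_left₀ (Real.exp_pos _).le h1 11
      _ ≤ 1 / 32 := by norm_num
  refine ⟨Real.exp (-11), Real.exp_pos _, by linarith, fun N p hp0 hp1 hμ δ hδ0 hδ1 => ?_⟩
  have hrate : Real.exp (-(δ ^ 2 * ((N : ℝ) * p)) / Real.exp (-11)) ≤
      Real.exp (-(32 * (δ ^ 2 * (N * p)))) := by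
    refine Real.exp_le_exp.mpr ?_
    have : 0 ≤ δ ^ 2 * (N * p) := by positivity
    rw [div_le_iff₀ (Real.exp_pos _)]
    nlinarith
  rcases le_total δ (1 / 4) with h | h
  · refine le_trans ?_ (exp_le_binomial_lower_tail hp0 hp1 hμ hδ0 h)
    refine mul_le_mul_of_nonneg_left (hrate.trans (Real.exp_le_exp.mpr ?_)) (Real.exp_pos _).le
    have : 0 ≤ δ ^ 2 * (N * p) := by positivity
    linarith
  · refine le_trans ?_ (exp_neg_le_binomial_lower_tail hp0.le hp1
      (mul_nonneg (sub_nonneg.mpr hδ1) (by linarith)))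
    refine (mul_le_of_le_one_left (Real.exp_pos _).le (by linarith)).trans
      (hrate.trans (Real.exp_le_exp.mpr ?_))
    nlinarith [mul_le_mul_of_nonneg_right (pow_le_pow_left₀ (by norm_num) h 2)
      (by linarith : (0 : ℝ) ≤ N * p)]
end

section
/- Consider placing m balls independently and uniformly at random into n ≥ 2 bins, where m ≥ n·ln n, and let X_i be the number of balls in bin i. Then E[min_{1≤i≤n} X_i] ≤ m/n − c·√(m·ln n / n) for some global constant c > 0 (independent of m and n). -/
/-- The number of balls landing in bin `i` when the balls are placed according
to `ω : Fin m → Fin n`. -/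
noncomputable def ballsInBin {m n : ℕ} (ω : Fin m → Fin n) (i : Fin n) : ℕ :=
  Nat.card {b : Fin m // ω b = i}

open Finset in
theorem ballsInBin_eq_card {m n : ℕ} (ω : Fin m → Fin n) (i : Fin n) :
    ballsInBin ω i = #{b | ω b = i} := by
  rw [ballsInBin, Nat.card_eq_fintype_card, Fintype.card_subtype]

theorem cast_ballsInBin {m n : ℕ} (ω : Fin m → Fin n) (i : Fin n) :
    (ballsInBin ω i : ℝ) = ∑ b, if ω b = i then 1 else 0 := by
  simp [ballsInBin_eq_card]

theorem pow_ballsInBin {m n : ℕ} (q : ℝ) (ω : Fin m → Fin n) (i : Fin n) :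
    q ^ ballsInBin ω i = ∏ b, if ω b = i then q else 1 := by
  rw [ballsInBin_eq_card, Finset.prod_ite]
  simp

theorem sum_ballsInBin {m n : ℕ} (ω : Fin m → Fin n) :
    ∑ i, (ballsInBin ω i : ℝ) = m := by
  simp_rw [cast_ballsInBin]
  rw [Finset.sum_comm]
  simp

theorem sum_fin_succ_fun {α : Type*} [Fintype α] {m : ℕ} (F : (Fin (m + 1) → α) → ℝ) :
    ∑ ω, F ω = ∑ ω : Fin m → α, ∑ j, F (Fin.cons j ω) := by
  rw [← (Fin.consEquiv (fun _ => α)).sum_comp, Fintype.sum_prod_type, Finset.sum_comm]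
  rfl

theorem sum_prod_fun {α : Type*} [Fintype α] [DecidableEq α] (m : ℕ) (h : α → ℝ) :
    ∑ ω : Fin m → α, ∏ b, h (ω b) = (∑ j, h j) ^ m := by
  rw [← Fintype.piFinset_univ, ← Finset.prod_univ_sum]
  simp

section Moments

variable {α : Type*} [Fintype α] (d : α → ℝ)

theorem sum_sum_fun (m : ℕ) :
    (∑ ω : Fin m → α, ∑ b, d (ω b)) * Fintype.card α =
      m * (∑ j, d j) * (Fintype.card α : ℝ) ^ m := by
  induction m with
  | zero => simp
  | succ m ih =>
    rw [sum_fin_succ_fun]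
    simp only [Fin.sum_univ_succ, Fin.cons_zero, Fin.cons_succ, Finset.sum_add_distrib,
      Finset.sum_const, Finset.card_univ, Fintype.card_fun, Fintype.card_fin, nsmul_eq_mul,
      ← Finset.mul_sum, Nat.cast_pow]
    push_cast
    linear_combination (Fintype.card α : ℝ) * ih

theorem sum_sq_sum_fun (h₁ : ∑ j, d j = 0) (m : ℕ) :
    (∑ ω : Fin m → α, (∑ b, d (ω b)) ^ 2) * Fintype.card α =
      m * (∑ j, d j ^ 2) * (Fintype.card α : ℝ) ^ m := by
  induction m with
  | zero => simp
  | succ m ih =>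
    have key (x : ℝ) : ∑ j, (d j + x) ^ 2 = ∑ j, d j ^ 2 + Fintype.card α * x ^ 2 := by
      have (j : α) : (d j + x) ^ 2 = d j ^ 2 + 2 * x * d j + x ^ 2 := by ring
      simp [this, Finset.sum_add_distrib, ← Finset.mul_sum, h₁]
    rw [sum_fin_succ_fun]
    simp only [Fin.sum_univ_succ, Fin.cons_zero, Fin.cons_succ, key, Finset.sum_add_distrib,
      Finset.sum_const, Finset.card_univ, Fintype.card_fun, Fintype.card_fin, nsmul_eq_mul,
      ← Finset.mul_sum, Nat.cast_pow]
    push_cast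
    linear_combination (Fintype.card α : ℝ) * ih

theorem sum_pow_four_sum_fun (h₁ : ∑ j, d j = 0) (h₃ : ∑ j, d j ^ 3 = 0) (m : ℕ) :
    (∑ ω : Fin m → α, (∑ b, d (ω b)) ^ 4) * (Fintype.card α : ℝ) ^ 2 =
      (m * (∑ j, d j ^ 4) * Fintype.card α + 3 * m * (m - 1) * (∑ j, d j ^ 2) ^ 2) *
        (Fintype.card α : ℝ) ^ m := by
  induction m with
  | zero => simp
  | succ m ih =>
    have key (x : ℝ) : ∑ j, (d j + x) ^ 4 =
        ∑ j, d j ^ 4 + (6 * ∑ j, d j ^ 2) * x ^ 2 + Fintype.card α * x ^ 4 := by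
      have (j : α) : (d j + x) ^ 4 =
          d j ^ 4 + 4 * x * d j ^ 3 + 6 * x ^ 2 * d j ^ 2 + 4 * x ^ 3 * d j + x ^ 4 := by ring
      simp only [this, Finset.sum_add_distrib, ← Finset.mul_sum, h₁, h₃, Finset.sum_const,
        Finset.card_univ, nsmul_eq_mul]
      ring
    have h₂ := sum_sq_sum_fun d h₁ m
    rw [sum_fin_succ_fun]
    simp only [Fin.sum_univ_succ, Fin.cons_zero, Fin.cons_succ, key, Finset.sum_add_distrib,
      Finset.sum_const, Finset.card_univ, Fintype.card_fun, Fintype.card_fin, nsmul_eq_mul,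
      ← Finset.mul_sum, Nat.cast_pow]
    push_cast
    linear_combination (Fintype.card α : ℝ) * ih +
      (6 * ∑ j, d j ^ 2) * (Fintype.card α : ℝ) * h₂

end Moments

set_option maxHeartbeats 1000000 in
/-- The smallest load is at most the average of the loads of two bins minus half their
difference, whose first absolute moment is bounded below by its second and fourth moments. -/
theorem sum_min_le_of_two_bins {m n : ℕ} (hn : 2 ≤ n) (hm : (n : ℝ) ≤ 2 * m)
    (M : (Fin m → Fin n) → ℝ) (hM : ∀ ω i, M ω ≤ ballsInBin ω i) :
    (∑ ω, M ω) / (n : ℝ) ^ m ≤ m / n - Real.sqrt (m / n) / 4 := by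
  have hn0 : (0 : ℝ) < n := by positivity
  obtain ⟨i, k, hik⟩ : ∃ i k : Fin n, i ≠ k :=
    ⟨⟨0, by omega⟩, ⟨1, by omega⟩, by simp⟩
  set d : Fin n → ℝ := fun j => (if j = i then 1 else 0) - (if j = k then 1 else 0) with hd
  set e : Fin n → ℝ := fun j => (if j = i then 1 else 0) + (if j = k then 1 else 0) with he
  have d1 : ∑ j, d j = 0 := by simp [hd]
  have d3 : ∑ j, d j ^ 3 = 0 := by
    rw [← d1]
    refine Finset.sum_congr rfl fun j _ => ?_
    simp only [hd]; split_ifs <;> norm_num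
  have e1 : ∑ j, e j = 2 := by simp [he, Finset.sum_add_distrib]; norm_num
  have d2 : ∑ j, d j ^ 2 = 2 := by
    rw [← e1]
    refine Finset.sum_congr rfl fun j _ => ?_
    simp only [hd, he]; split_ifs <;> simp_all
  have d4 : ∑ j, d j ^ 4 = 2 := by
    rw [← e1]
    refine Finset.sum_congr rfl fun j _ => ?_
    simp only [hd, he]; split_ifs <;> first | (norm_num; done) | simp_all
  have S1 := sum_sum_fun e m
  have S2 := sum_sq_sum_fun d d1 m
  have S4 := sum_pow_four_sum_fun d d1 d3 m
  rw [e1, Fintype.card_fin] at S1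
  rw [d2, Fintype.card_fin] at S2
  rw [d4, d2, Fintype.card_fin] at S4
  set μ : ℝ := m / n with hμ
  have hμm : (m : ℝ) = μ * n := by rw [hμ]; field_simp
  have hμ2 : 1 / 2 ≤ μ := by rw [hμ, le_div_iff₀ hn0]; linarith
  have hμ0 : 0 < μ := by linarith
  set N : ℝ := (n : ℝ) ^ m with hN
  have hN0 : 0 < N := by positivity
  have T1 : ∑ ω : Fin m → Fin n, ∑ b, e (ω b) = 2 * μ * N := by
    apply mul_right_cancel₀ hn0.ne'
    rw [S1, hμm]; ring
  have T2 : ∑ ω : Fin m → Fin n, (∑ b, d (ω b)) ^ 2 = 2 * μ * N := by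
    apply mul_right_cancel₀ hn0.ne'
    rw [S2, hμm]; ring
  have T4 : ∑ ω : Fin m → Fin n, (∑ b, d (ω b)) ^ 4 ≤ 16 * μ ^ 2 * N := by
    apply le_of_mul_le_mul_right _ (show (0 : ℝ) < (n : ℝ) ^ 2 by positivity)
    rw [S4]
    have : (m : ℝ) * 2 * n + 3 * m * (m - 1) * 2 ^ 2 ≤ 16 * μ ^ 2 * n ^ 2 := by
      rw [hμm]
      have h1 : 0 ≤ μ * n ^ 2 * (μ - 1 / 2) := by
        apply mul_nonneg (by positivity); linarith
      have h2 : 0 ≤ μ * n := by positivity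
      nlinarith
    nlinarith
  set s := Real.sqrt μ with hs
  have hs0 : 0 < s := Real.sqrt_pos.mpr hμ0
  have hss : s ^ 2 = μ := Real.sq_sqrt hμ0.le
  -- AM-GM in the form `3 y² ≤ 2 y + y⁴`, with `y = |x| / (3 s)`
  have pt (x : ℝ) : x ^ 2 / (2 * s) - x ^ 4 * (1 / (54 * s ^ 3)) ≤ |x| := by
    have h : 0 ≤ |x| / (3 * s) := by positivity
    have hx : |x| = 3 * s * (|x| / (3 * s)) := by field_simp
    generalize |x| / (3 * s) = y at h hx
    rw [← sq_abs x, show x ^ 4 = |x| ^ 4 by rw [← abs_pow, abs_of_nonneg (by positivity)], hx]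
    have : 3 * y ^ 2 - y ^ 4 ≤ 2 * y := by
      have : 0 ≤ y * ((y - 1) ^ 2 * (y + 2)) := by positivity
      nlinarith
    have e : (3 * s * y) ^ 2 / (2 * s) - (3 * s * y) ^ 4 * (1 / (54 * s ^ 3)) =
        3 / 2 * s * (3 * y ^ 2 - y ^ 4) := by
      field_simp
      ring
    rw [e]
    nlinarith
  have ptM (ω : Fin m → Fin n) : M ω ≤ (∑ b, e (ω b)) / 2 -
      ((∑ b, d (ω b)) ^ 2 / (2 * s) - (∑ b, d (ω b)) ^ 4 * (1 / (54 * s ^ 3))) / 2 := by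
    have h := pt (∑ b, d (ω b))
    have hi := hM ω i
    have hk := hM ω k
    rw [cast_ballsInBin] at hi hk
    have hdd : ∑ b, d (ω b) =
        (∑ b, if ω b = i then (1 : ℝ) else 0) - ∑ b, if ω b = k then (1 : ℝ) else 0 := by
      simp only [hd, Finset.sum_sub_distrib]
    have hee : ∑ b, e (ω b) =
        (∑ b, if ω b = i then (1 : ℝ) else 0) + ∑ b, if ω b = k then (1 : ℝ) else 0 := by
      simp only [he, Finset.sum_add_distrib]
    have : |∑ b, d (ω b)| ≤ (∑ b, e (ω b)) - 2 * M ω := by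
      rw [hdd, hee, abs_le]; constructor <;> linarith
    linarith
  rw [div_le_iff₀ hN0]
  refine (Finset.sum_le_sum fun ω _ => ptM ω).trans ?_
  rw [Finset.sum_sub_distrib, ← Finset.sum_div, ← Finset.sum_div, Finset.sum_sub_distrib,
    ← Finset.sum_mul, ← Finset.sum_div, T1, T2]
  have h4 : (∑ ω : Fin m → Fin n, (∑ b, d (ω b)) ^ 4) * (1 / (54 * s ^ 3)) ≤ 8 / 27 * s * N := by
    calc _ ≤ 16 * μ ^ 2 * N * (1 / (54 * s ^ 3)) := by gcongr
      _ = 8 / 27 * s * N := by rw [← hss]; field_simp; ring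
  have h2 : 2 * μ * N / (2 * s) = s * N := by rw [← hss]; field_simp
  rw [h2]
  nlinarith [mul_pos hs0 hN0]

theorem add_sq_half_le_neg_log_one_sub {x : ℝ} (hx0 : 0 ≤ x) (hx1 : x < 1) :
    x + x ^ 2 / 2 ≤ -Real.log (1 - x) := by
  have h := Real.hasSum_pow_div_log_of_abs_lt_one (abs_lt.mpr ⟨by linarith, hx1⟩)
  have := sum_le_hasSum (Finset.range 2) (fun i _ => by positivity) h
  simpa [Finset.sum_range_succ, one_add_one_eq_two] using this

theorem neg_log_one_sub_le {x : ℝ} (hx1 : x < 1) : -Real.log (1 - x) ≤ x / (1 - x) := by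
  have h := Real.one_sub_inv_le_log_of_pos (sub_pos.mpr hx1)
  have : x / (1 - x) = (1 - x)⁻¹ - 1 := by
    have : 1 - x ≠ 0 := (sub_pos.mpr hx1).ne'
    field_simp; ring
  linarith

/-- First moment of the exponential weight `∑ i, q ^ X i`. -/
theorem sum_sum_pow_ballsInBin (m n : ℕ) (q : ℝ) :
    ∑ ω : Fin m → Fin n, ∑ i, q ^ ballsInBin ω i = n * (n - (1 - q)) ^ m := by
  rw [Finset.sum_comm]
  have (i : Fin n) : ∑ ω : Fin m → Fin n, q ^ ballsInBin ω i = (n - (1 - q)) ^ m := by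
    simp_rw [pow_ballsInBin]
    rw [sum_prod_fun m fun j => if j = i then q else 1]
    congr 1
    have (j : Fin n) : (if j = i then q else 1) = 1 - if j = i then 1 - q else 0 := by
      split_ifs <;> ring
    simp [this]
  simp [this]

/-- Second moment of the exponential weight `∑ i, q ^ X i`. -/
theorem sum_sq_sum_pow_ballsInBin_le {m n : ℕ} (hn : 2 ≤ n) {q : ℝ} (hq : 0 ≤ q) :
    ∑ ω : Fin m → Fin n, (∑ i, q ^ ballsInBin ω i) ^ 2 ≤
      n * (n - (1 - q ^ 2)) ^ m + n ^ 2 * (n - 2 * (1 - q)) ^ m := by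
  have hn2 : (2 : ℝ) ≤ n := by exact_mod_cast hn
  have hpos : 0 ≤ ((n : ℝ) - 2 * (1 - q)) ^ m := pow_nonneg (by linarith) m
  have key (i k : Fin n) : ∑ ω : Fin m → Fin n, q ^ ballsInBin ω i * q ^ ballsInBin ω k ≤
      (if i = k then (n - (1 - q ^ 2)) ^ m else 0) + (n - 2 * (1 - q)) ^ m := by
    simp_rw [pow_ballsInBin, ← Finset.prod_mul_distrib]
    rw [sum_prod_fun m fun j => (if j = i then q else 1) * if j = k then q else 1]
    split_ifs with h
    · subst h
      have (j : Fin n) : ((if j = i then q else 1) * if j = i then q else 1) =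
          1 - if j = i then 1 - q ^ 2 else 0 := by
        split_ifs <;> ring
      simp only [this, Finset.sum_sub_distrib, Finset.sum_const, Finset.card_univ,
        Fintype.card_fin, nsmul_eq_mul, mul_one, Finset.sum_ite_eq', Finset.mem_univ, if_true]
      linarith
    · have (j : Fin n) : ((if j = i then q else 1) * if j = k then q else 1) =
          1 - ((if j = i then 1 - q else 0) + if j = k then 1 - q else 0) := by
        split_ifs with h1 h2
        · exact absurd (h1.symm.trans h2) h
        all_goals ring
      simp only [this, Finset.sum_sub_distrib, Finset.sum_add_distrib, Finset.sum_const,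
        Finset.card_univ, Fintype.card_fin, nsmul_eq_mul, mul_one, Finset.sum_ite_eq',
        Finset.mem_univ, if_true]
      apply le_of_eq
      ring
  simp_rw [sq (∑ i, _), Finset.sum_mul_sum]
  rw [Finset.sum_comm]
  calc _ ≤ ∑ i : Fin n, ∑ k : Fin n,
        ((if i = k then ((n : ℝ) - (1 - q ^ 2)) ^ m else 0) + (n - 2 * (1 - q)) ^ m) := by
        refine Finset.sum_le_sum fun i _ => ?_
        rw [Finset.sum_comm]
        exact Finset.sum_le_sum fun k _ => key i k
    _ = _ := by simp [Finset.sum_add_distrib]; ring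

set_option maxHeartbeats 1000000 in
/-- An exponential-weights second moment argument. -/
theorem sum_min_le_of_log_large {m n : ℕ} (hL : 32 * Real.log 2 ≤ Real.log n)
    (hm : (n : ℝ) * Real.log n ≤ m)
    (M : (Fin m → Fin n) → ℕ) (hM : ∀ ω i, M ω ≤ ballsInBin ω i) :
    (∑ ω, (M ω : ℝ)) / (n : ℝ) ^ m ≤ m / n - 1 / 100 * Real.sqrt (m / n * Real.log n) := by
  have hlog2 := Real.log_two_gt_d9
  have hn0 : (0 : ℝ) < n := by
    rcases Nat.eq_zero_or_pos n with rfl | h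
    · simp at hL; linarith
    · exact_mod_cast h
  have hn9 : (9 : ℝ) ≤ n := by
    have h := Real.log_le_sub_one_of_pos hn0
    linarith
  have hn2 : 2 ≤ n := by
    have : (2 : ℝ) ≤ n := by linarith
    exact_mod_cast this
  set L := Real.log n with hLdef
  set μ : ℝ := m / n with hμ
  have hμm : (m : ℝ) = μ * n := by rw [hμ]; field_simp
  have hL0 : 0 < L := by linarith
  have hLμ : L ≤ μ := by rw [hμ, le_div_iff₀ hn0]; linarith
  have hμ0 : 0 < μ := by linarith
  set l := Real.sqrt (μ * L) / (2 * μ) with hl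
  have hl0 : 0 < l := by positivity
  have hlμ : l ^ 2 * μ = L / 4 := by
    rw [hl, div_pow, Real.sq_sqrt (by positivity)]
    field_simp
    norm_num
  have hl1 : l ≤ 1 / 2 := by
    by_contra! h
    have : 1 / 4 < l ^ 2 := by nlinarith
    nlinarith
  have hsq : Real.sqrt (μ * L) = 2 * μ * l := by rw [hl]; field_simp
  set N : ℝ := (n : ℝ) ^ m with hN
  have hN0 : 0 < N := by positivity
  set B : ℝ := (n - l) ^ m with hB
  have hnl : 0 < (n : ℝ) - l := by linarith
  have hB0 : 0 < B := pow_pos hnl m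
  set W : (Fin m → Fin n) → ℝ := fun ω => ∑ i, (1 - l) ^ ballsInBin ω i with hW
  have W1 : ∑ ω, W ω = n * B := by
    rw [hW, sum_sum_pow_ballsInBin, hB]; simp
  have W2 : ∑ ω, W ω ^ 2 ≤ 2 * n ^ 2 * B ^ 2 / N := by
    refine (sum_sq_sum_pow_ballsInBin_le hn2 (by linarith)).trans ?_
    have hBN : B ^ 2 / N = ((n - l) ^ 2 / n) ^ m := by
      rw [hB, hN, div_pow, ← pow_mul, ← pow_mul, mul_comm]
    have a1 : ((n : ℝ) - 2 * (1 - (1 - l))) ^ m ≤ B ^ 2 / N := by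
      rw [hBN]
      refine pow_le_pow_left₀ (by linarith) ?_ m
      rw [le_div_iff₀ hn0]; nlinarith
    have a2 : ((n : ℝ) - (1 - (1 - l) ^ 2)) ^ m ≤ B ^ 2 / N * n := by
      have h1 : (n : ℝ) - (1 - (1 - l) ^ 2) ≤ (n - l) ^ 2 / n * Real.exp (2 * l ^ 2 / n) := by
        have h2 := Real.add_one_le_exp (2 * l ^ 2 / n)
        have h3 : (n : ℝ) - (1 - (1 - l) ^ 2) ≤ (n - l) ^ 2 / n * (2 * l ^ 2 / n + 1) := by
          have : (n - l) ^ 2 / n * (2 * l ^ 2 / n + 1) =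
              (n - l) ^ 2 * (2 * l ^ 2 + n) / (n : ℝ) ^ 2 := by field_simp
          rw [this, le_div_iff₀ (by positivity)]
          have h4 : 0 ≤ l ^ 2 * (n * (n - 4 * l) + n + 2 * l ^ 2) := by
            have : 0 ≤ (n : ℝ) - 4 * l := by linarith
            positivity
          nlinarith
        exact h3.trans (by gcongr)
      calc _ ≤ ((n - l) ^ 2 / n * Real.exp (2 * l ^ 2 / n)) ^ m :=
            pow_le_pow_left₀ (by nlinarith) h1 m
        _ = B ^ 2 / N * Real.exp (L / 2) := by
            rw [mul_pow, ← hBN, ← Real.exp_nat_mul]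
            congr 2
            rw [hμm]
            field_simp
            linarith
        _ ≤ B ^ 2 / N * n := by
            gcongr
            rw [← Real.exp_log hn0]
            exact Real.exp_le_exp.mpr (by linarith)
    calc _ ≤ n * (B ^ 2 / N * n) + n ^ 2 * (B ^ 2 / N) := by gcongr
      _ = _ := by ring
  have hMμ (ω : Fin m → Fin n) : (M ω : ℝ) ≤ μ := by
    rw [hμ, le_div_iff₀ hn0, ← sum_ballsInBin ω]
    calc (M ω : ℝ) * n = ∑ _i : Fin n, (M ω : ℝ) := by simp [mul_comm]
      _ ≤ _ := Finset.sum_le_sum fun i _ => by exact_mod_cast hM ω i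
  have hMt (ω : Fin m → Fin n) (h : 1 / 2 ≤ W ω * N / (n * B)) : (M ω : ℝ) ≤ μ - μ * l / 6 := by
    have hWM : W ω ≤ n * (1 - l) ^ M ω := by
      calc W ω ≤ ∑ _i : Fin n, (1 - l) ^ M ω := Finset.sum_le_sum fun i _ =>
            pow_le_pow_of_le_one (by linarith) (by linarith) (hM ω i)
        _ = _ := by simp
    have hp : (1 - l / n) ^ m / 2 ≤ (1 - l) ^ M ω := by
      have : (1 - l / n) ^ m = B / N := by
        rw [hB, hN, ← div_pow]; congr 1; field_simp
      rw [this]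
      rw [le_div_iff₀ (by positivity)] at h
      have h2 : n * (B / 2) ≤ n * ((1 - l) ^ M ω * N) := by nlinarith
      have h3 := le_of_mul_le_mul_left h2 hn0
      rw [div_div, div_le_iff₀ (by positivity)]
      linarith
    have hln : l / n < 1 := by rw [div_lt_one hn0]; linarith
    have hlog := Real.log_le_log (div_pos (pow_pos (sub_pos.mpr hln) m) two_pos) hp
    rw [Real.log_div (pow_pos (sub_pos.mpr hln) m).ne' two_ne_zero, Real.log_pow,
      Real.log_pow] at hlog
    have b1 := add_sq_half_le_neg_log_one_sub hl0.le (by linarith : l < 1)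
    have b2 := neg_log_one_sub_le hln
    have b3 : m * (l / n / (1 - l / n)) ≤ μ * l + μ * l ^ 2 / 8 := by
      have : m * (l / n / (1 - l / n)) = μ * l * (n / (n - l)) := by
        rw [hμm]
        have : (n : ℝ) - l ≠ 0 := hnl.ne'
        field_simp
      rw [this]
      have : (n : ℝ) / (n - l) ≤ 1 + l / 8 := by
        rw [div_le_iff₀ hnl]; nlinarith
      calc _ ≤ μ * l * (1 + l / 8) := by gcongr
        _ = _ := by ring
    have b4 : (m : ℝ) * -Real.log (1 - l / n) ≤ m * (l / n / (1 - l / n)) := by gcongr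
    have b5 : (M ω : ℝ) * (l + l ^ 2 / 2) ≤ M ω * -Real.log (1 - l) := by gcongr
    have b6 : (M ω : ℝ) * (l + l ^ 2 / 2) ≤ μ * l + μ * l ^ 2 / 4 := by
      have : Real.log 2 ≤ μ * l ^ 2 / 8 := by nlinarith
      linarith
    have b7 : μ * l + μ * l ^ 2 / 4 ≤ (μ - μ * l / 6) * (l + l ^ 2 / 2) := by
      have : 0 ≤ μ * l ^ 2 * (1 - l) := by
        have : 0 ≤ 1 - l := by linarith
        positivity
      nlinarith
    exact le_of_mul_le_mul_right (b6.trans b7) (by positivity)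
  have pt (ω : Fin m → Fin n) : (M ω : ℝ) ≤
      μ - μ * l / 6 * ((13 / 2 * (W ω * (N / (n * B))) - W ω ^ 2 * (N / (n * B)) ^ 2 - 3) / 8) := by
    have h1 := hMμ ω
    have h2 := hMt ω
    rw [mul_div_assoc] at h2
    rw [← mul_pow]
    generalize W ω * (N / (n * B)) = w at h2
    have ht : 0 < μ * l / 6 := by positivity
    rcases le_total (1 / 2) w with h | h
    · have : (13 / 2 * w - w ^ 2 - 3) / 8 ≤ 1 := by nlinarith [sq_nonneg (w - 13 / 4)]
      nlinarith [h2 h]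
    · have : (13 / 2 * w - w ^ 2 - 3) / 8 ≤ 0 := by nlinarith
      nlinarith
  rw [div_le_iff₀ hN0]
  refine (Finset.sum_le_sum fun ω _ => pt ω).trans ?_
  clear_value μ
  have hcard : (Fintype.card (Fin m → Fin n) : ℝ) = N := by simp [hN]
  rw [Finset.sum_sub_distrib, ← Finset.mul_sum, ← Finset.sum_div, Finset.sum_sub_distrib,
    Finset.sum_sub_distrib, ← Finset.mul_sum, ← Finset.sum_mul, ← Finset.sum_mul, W1]
  simp only [Finset.sum_const, Finset.card_univ, nsmul_eq_mul, hcard]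
  have c1 : n * B * (N / (n * B)) = N := by field_simp
  have c2 : (∑ ω, W ω ^ 2) * (N / (n * B)) ^ 2 ≤ 2 * N := by
    calc _ ≤ 2 * n ^ 2 * B ^ 2 / N * (N / (n * B)) ^ 2 := by gcongr
      _ = 2 * N := by field_simp
  rw [c1, hsq]
  have c3 : μ * l / 6 * (3 / 16 * N) ≤ μ * l / 6 *
      ((13 / 2 * N - (∑ ω, W ω ^ 2) * (N / (n * B)) ^ 2 - N * 3) / 8) := by
    gcongr
    linarith
  nlinarith [mul_pos (mul_pos hμ0 hl0) hN0]

/-- Lemma `ballsBinsMin`. Throwing `m` balls independently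
and uniformly at random into `n ≥ 2` bins, where `m ≥ n·ln n`, the expected
minimum load of a bin is at most `m/n - c·√(m·ln n/n)` for a global constant
`c > 0`. The expectation is written as a uniform average over all `n^m`
placements `ω : Fin m → Fin n`. -/
theorem balls_in_bins_expected_min :
    ∃ c : ℝ, 0 < c ∧
      ∀ m n : ℕ, ∀ hn : 2 ≤ n, (n : ℝ) * Real.log n ≤ (m : ℝ) →
        (∑ ω : Fin m → Fin n,
            ((Finset.univ.inf'
              (Finset.univ_nonempty_iff.mpr ⟨(⟨0, by omega⟩ : Fin n)⟩)
              fun i => ballsInBin ω i : ℕ) : ℝ)) / (n : ℝ) ^ m ≤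
          (m : ℝ) / n - c * Real.sqrt ((m : ℝ) * Real.log n / n) := by
  refine ⟨1 / 100, by norm_num, fun m n hn hm => ?_⟩
  have hn0 : (0 : ℝ) < n := by positivity
  have hM (ω : Fin m → Fin n) (i : Fin n) :
      (Finset.univ.inf' (Finset.univ_nonempty_iff.mpr ⟨(⟨0, by omega⟩ : Fin n)⟩)
        fun i => ballsInBin ω i) ≤ ballsInBin ω i :=
    Finset.inf'_le _ (Finset.mem_univ i)
  rw [mul_div_right_comm]
  rcases le_total (32 * Real.log 2) (Real.log n) with hL | hL
  · exact sum_min_le_of_log_large hL hm _ hM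
  · have hlog : Real.log 2 ≤ Real.log n := Real.log_le_log two_pos (by exact_mod_cast hn)
    have h2 := Real.log_two_gt_d9
    have h2' := Real.log_two_lt_d9
    refine (sum_min_le_of_two_bins hn (by nlinarith) _
      fun ω i => Nat.cast_le.mpr (hM ω i)).trans ?_
    have : Real.sqrt (m / n * Real.log n) ≤ Real.sqrt (m / n) * 25 := by
      rw [Real.sqrt_mul (by positivity)]
      gcongr
      rw [Real.sqrt_le_left (by norm_num)]
      linarith
    linarith
end

section
/- Consider placing m balls independently and uniformly at random into n bins, and let X_i be the number of balls in bin i. Then for every threshold t ∈ ℝ, Pr[min_{1≤i≤n} X_i > t] ≤ (Pr[X_1 > t])^n. More precisely, for the events E_i = {X_i > t}, Pr[E_i | E_1 ∩ ⋯ ∩ E_{i−1}] ≤ Pr[E_i] for each i, and hence Pr[E_1 ∩ ⋯ ∩ E_n] ≤ ∏_{i=1}^n Pr[E_i]. -/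
/-- Probability of an event `Q` under the uniform measure on all `n^m`
placements of `m` balls into `n` bins. -/
noncomputable def ballsPr (m n : ℕ) (Q : (Fin m → Fin n) → Prop) : ℝ :=
  (Nat.card {ω : Fin m → Fin n // Q ω} : ℝ) / (n : ℝ) ^ m

/-- Harris-type inequality on a finite product space: a function that increases with the set of
coordinates equal to `a` is negatively correlated with any function that decreases whenever
coordinates are replaced by `a`. -/
theorem card_pow_mul_sum_mul_le_sum_mul_sum {α : Type*} [Fintype α] (a : α) (m : ℕ)
    (f g : (Fin m → α) → ℝ)
    (hf : ∀ ω ω', (∀ b, ω b = a → ω' b = a) → f ω ≤ f ω')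
    (hg : ∀ ω ω', (∀ b, ω' b = ω b ∨ ω' b = a) → g ω' ≤ g ω) :
    (Fintype.card α : ℝ) ^ m * ∑ ω, f ω * g ω ≤ (∑ ω, f ω) * ∑ ω, g ω := by
  induction m with
  | zero => simp
  | succ m ih =>
    have hsum : ∀ h : (Fin (m + 1) → α) → ℝ,
        ∑ ω, h ω = ∑ x : α, ∑ ω : Fin m → α, h (Fin.cons x ω) := fun h => by
      rw [← Fintype.sum_prod_type', ← (Fin.consEquiv fun _ => α).sum_comp]
      rfl
    have hanti : Antivary (fun x : α => ∑ ω : Fin m → α, f (Fin.cons x ω))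
        (fun x : α => ∑ ω : Fin m → α, g (Fin.cons x ω)) := by
      intro x y hxy
      have hy : y ≠ a := by
        rintro rfl
        refine hxy.not_ge (Finset.sum_le_sum fun ω _ => hg _ _ fun b => ?_)
        cases b using Fin.cases <;> simp
      refine Finset.sum_le_sum fun ω _ => hf _ _ fun b => ?_
      cases b using Fin.cases <;> simp [hy]
    rw [hsum, hsum, hsum, pow_succ', mul_assoc, Finset.mul_sum]
    refine le_trans ?_ hanti.card_mul_sum_le_sum_mul_sum
    refine mul_le_mul_of_nonneg_left (Finset.sum_le_sum fun x _ => ?_) (Nat.cast_nonneg _)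
    refine ih (fun ω => f (Fin.cons x ω)) (fun ω => g (Fin.cons x ω)) ?_ ?_
    · refine fun ω ω' h => hf _ _ fun b => ?_
      cases b using Fin.cases
      · simp
      · simpa using h _
    · refine fun ω ω' h => hg _ _ fun b => ?_
      cases b using Fin.cases
      · simp
      · simpa using h _

theorem ballsPr_eq_sum (m n : ℕ) (Q : (Fin m → Fin n) → Prop) [DecidablePred Q] :
    ballsPr m n Q = (∑ ω, if Q ω then (1 : ℝ) else 0) / (n : ℝ) ^ m := by
  simp [ballsPr, Fintype.card_subtype]

theorem ballsPr_nonneg (m n : ℕ) (Q : (Fin m → Fin n) → Prop) : 0 ≤ ballsPr m n Q := by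
  unfold ballsPr
  positivity

theorem ballsPr_and_le_mul {m n : ℕ} (hn : 1 ≤ n) (i : Fin n) (P Q : (Fin m → Fin n) → Prop)
    (hP : ∀ ω ω', (∀ b, ω b = i → ω' b = i) → P ω → P ω')
    (hQ : ∀ ω ω', (∀ b, ω' b = ω b ∨ ω' b = i) → Q ω' → Q ω) :
    ballsPr m n (fun ω => P ω ∧ Q ω) ≤ ballsPr m n P * ballsPr m n Q := by
  classical
  have hpos : (0 : ℝ) < (n : ℝ) ^ m := by positivity
  have key := card_pow_mul_sum_mul_le_sum_mul_sum i m
    (fun ω => if P ω then (1 : ℝ) else 0) (fun ω => if Q ω then (1 : ℝ) else 0)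
    (fun ω ω' h => by
      have := hP ω ω' h
      split_ifs <;> simp_all)
    (fun ω ω' h => by
      have := hQ ω ω' h
      split_ifs <;> simp_all)
  have hmul : ∀ ω, (if P ω then (1 : ℝ) else 0) * (if Q ω then (1 : ℝ) else 0) =
      if P ω ∧ Q ω then 1 else 0 := fun ω => by
    by_cases hp : P ω <;> simp [hp]
  simp only [hmul, Fintype.card_fin] at key
  rw [ballsPr_eq_sum, ballsPr_eq_sum, ballsPr_eq_sum, div_mul_div_comm,
    div_le_div_iff₀ hpos (by positivity)]
  calc _ = ((n : ℝ) ^ m * ∑ ω, if P ω ∧ Q ω then (1 : ℝ) else 0) * (n : ℝ) ^ m := by ring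
    _ ≤ _ := by gcongr

theorem ballsInBin_le_of_imp {m n : ℕ} {ω ω' : Fin m → Fin n} {i : Fin n}
    (h : ∀ b, ω b = i → ω' b = i) : ballsInBin ω i ≤ ballsInBin ω' i :=
  Nat.card_le_card_of_injective (Subtype.map id h) (Subtype.map_injective h Function.injective_id)

theorem ballsPr_lt_ballsInBin_and_le_mul {m n : ℕ} (hn : 1 ≤ n) (t : ℝ) (i : Fin n) :
    ballsPr m n (fun ω => ∀ j : Fin n, j ≤ i → t < (ballsInBin ω j : ℝ)) ≤
      ballsPr m n (fun ω => t < (ballsInBin ω i : ℝ)) *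
        ballsPr m n (fun ω => ∀ j : Fin n, j < i → t < (ballsInBin ω j : ℝ)) := by
  have hsplit : (fun ω : Fin m → Fin n => ∀ j : Fin n, j ≤ i → t < (ballsInBin ω j : ℝ)) =
      fun ω => t < (ballsInBin ω i : ℝ) ∧ ∀ j : Fin n, j < i → t < (ballsInBin ω j : ℝ) := by
    funext ω
    simp only [le_iff_eq_or_lt, or_imp, forall_and, forall_eq]
  rw [hsplit]
  refine ballsPr_and_le_mul hn i _ _ (fun ω ω' h hω => ?_) (fun ω ω' h hω j hj => ?_)
  · exact hω.trans_le (Nat.cast_le.2 (ballsInBin_le_of_imp h))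
  · refine (hω j hj).trans_le (Nat.cast_le.2 (ballsInBin_le_of_imp fun b hb => ?_))
    rcases h b with h | h
    · exact h ▸ hb
    · exact absurd (hb.symm.trans h) hj.ne

theorem ballsPr_lt_ballsInBin_eq {m n : ℕ} (t : ℝ) (i j : Fin n) :
    ballsPr m n (fun ω => t < (ballsInBin ω i : ℝ)) =
      ballsPr m n (fun ω => t < (ballsInBin ω j : ℝ)) := by
  have hcard : ∀ ω : Fin m → Fin n, ballsInBin (Equiv.swap i j ∘ ω) j = ballsInBin ω i :=
    fun ω => by simp [ballsInBin, Equiv.swap_apply_eq_iff]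
  unfold ballsPr
  congr 2
  refine Nat.card_congr ((Equiv.arrowCongr (Equiv.refl _) (Equiv.swap i j)).subtypeEquiv
    fun ω => ?_)
  change _ ↔ t < (ballsInBin (Equiv.swap i j ∘ ω) j : ℝ)
  rw [hcard]

theorem ballsPr_forall_lt_le_pow {m n : ℕ} (hn : 1 ≤ n) (t : ℝ) (i : Fin n) (k : ℕ) (hk : k ≤ n) :
    ballsPr m n (fun ω => ∀ j : Fin n, (j : ℕ) < k → t < (ballsInBin ω j : ℝ)) ≤
      ballsPr m n (fun ω => t < (ballsInBin ω i : ℝ)) ^ k := by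
  induction k with
  | zero =>
    have : (n : ℝ) ^ m ≠ 0 := by positivity
    simp [ballsPr_eq_sum, this]
  | succ k ih =>
    have hstep := ballsPr_lt_ballsInBin_and_le_mul (m := m) hn t ⟨k, hk⟩
    simp only [Fin.le_def, Fin.lt_def] at hstep
    simp only [Nat.lt_succ_iff, pow_succ']
    rw [ballsPr_lt_ballsInBin_eq t ⟨k, hk⟩ i] at hstep
    exact hstep.trans (mul_le_mul_of_nonneg_left (ih (by omega)) (ballsPr_nonneg _ _ _))

/-- negative association of bin loads: throwing `m` balls
uniformly into `n ≥ 1` bins, for every threshold `t`: the events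
`E i = {X i > t}` satisfy `Pr[E i | E 0 ∩ ⋯ ∩ E (i-1)] ≤ Pr[E i]` (stated
multiplicatively), hence `Pr[⋂ i, E i] ≤ ∏ i, Pr[E i]`, and in particular
`Pr[min_i X i > t] ≤ Pr[E 0]^n`. -/
theorem balls_in_bins_min_product_bound (m n : ℕ) (hn : 1 ≤ n) (t : ℝ) :
    (∀ i : Fin n,
      ballsPr m n (fun ω => ∀ j : Fin n, j ≤ i → t < (ballsInBin ω j : ℝ)) ≤
        ballsPr m n (fun ω => t < (ballsInBin ω i : ℝ)) *
          ballsPr m n (fun ω => ∀ j : Fin n, j < i → t < (ballsInBin ω j : ℝ))) ∧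
    ballsPr m n (fun ω => ∀ i : Fin n, t < (ballsInBin ω i : ℝ)) ≤
      ∏ i : Fin n, ballsPr m n (fun ω => t < (ballsInBin ω i : ℝ)) ∧
    ballsPr m n (fun ω => ∀ i : Fin n, t < (ballsInBin ω i : ℝ)) ≤
      (ballsPr m n (fun ω => t < (ballsInBin ω (⟨0, by omega⟩ : Fin n) : ℝ))) ^ n := by
  have hpow : ballsPr m n (fun ω => ∀ i : Fin n, t < (ballsInBin ω i : ℝ)) ≤
      (ballsPr m n (fun ω => t < (ballsInBin ω (⟨0, by omega⟩ : Fin n) : ℝ))) ^ n := by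
    simpa using ballsPr_forall_lt_le_pow (m := m) hn t ⟨0, by omega⟩ n le_rfl
  refine ⟨ballsPr_lt_ballsInBin_and_le_mul hn t, ?_, hpow⟩
  rw [Finset.prod_congr rfl fun i _ => ballsPr_lt_ballsInBin_eq t i ⟨0, by omega⟩]
  simpa using hpow
end
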